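/- arXiv:1908.03941 — 2 statements merged into one kernel-verified Lean document; each statement's English description precedes it below -/
import Mathlib

section
/- Let p be a prime, r ≥ 1 and q = p^r. Let F be a separably closed field of characteristic p and let k be a finite field of characteristic p. Then the additive endomorphism of the tensor product F ⊗_{F_p} k (tensor product over the prime field F_p = Z/pZ) determined on simple tensors by x ⊗ y ↦ x^q ⊗ y − x ⊗ y (that is, (q-power Frobenius of F) ⊗ id_k minus the identity) is surjective. -/
open TensorProduct

/-- Let `p` be a prime, `r ≥ 1`, `q = p ^ r`.  Let `F` be a separably closed field
of characteristic `p` and `k` a finite field of characteristic `p`.  The additive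
endomorphism of `F ⊗_{𝔽_p} k` determined on simple tensors by
`x ⊗ y ↦ x ^ q ⊗ y - x ⊗ y` (i.e. `φ_q ⊗ id - id`) is surjective. -/
theorem frobenius_tensor_sub_id_surjective
    (p r : ℕ) (hp : p.Prime) (hr : 1 ≤ r)
    (F k : Type*) [Field F] [IsSepClosed F] [CharP F p]
    [Field k] [Finite k] [CharP k p]
    [Algebra (ZMod p) F] [Algebra (ZMod p) k]
    (f : TensorProduct (ZMod p) F k →+ TensorProduct (ZMod p) F k)
    (hf : ∀ (x : F) (y : k), f (x ⊗ₜ[ZMod p] y) = (x ^ (p ^ r)) ⊗ₜ[ZMod p] y - x ⊗ₜ[ZMod p] y) :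
    Function.Surjective f := by
  have key : ∀ z : F, ∃ x : F, x ^ (p ^ r) - x = z := by
    intro z
    have hdvd : p ∣ p ^ r := dvd_pow_self p (by omega)
    have h2 : 2 ≤ p ^ r := hp.two_le.trans (Nat.le_self_pow (by omega) p)
    obtain ⟨x, hx⟩ := IsSepClosed.exists_root_C_mul_X_pow_add_C_mul_X_add_C'
      p (p ^ r) (1 : F) (-1) (-z) hdvd h2 (by simp)
    refine ⟨x, ?_⟩
    linear_combination hx
  intro t
  induction t using TensorProduct.induction_on with
  | zero => exact ⟨0, map_zero f⟩
  | tmul z y =>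
    obtain ⟨x, hx⟩ := key z
    exact ⟨x ⊗ₜ[ZMod p] y, by rw [hf, ← TensorProduct.sub_tmul, hx]⟩
  | add a b ha hb =>
    obtain ⟨u, rfl⟩ := ha
    obtain ⟨v, rfl⟩ := hb
    exact ⟨u + v, map_add f u v⟩
end

section
/- Let k be a finite field of characteristic p, let r ≥ 1 and q = p^r, and let F = k((X)) be the field of formal Laurent series over k. Let F^q = {x^q : x ∈ F} denote the image of the r-th iterate of the Frobenius endomorphism of F, which is a subfield of F. Then F is a finite extension of F^q of degree exactly q, i.e., [k((X)) : k((X))^q] = q. -/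
open HahnSeries in
theorem aux_coeff_pow (p r : ℕ) (hp : p.Prime) (k : Type*) [Field k] [CharP k p]
    (x : LaurentSeries k) (m : ℤ) :
    (x ^ (p ^ r)).coeff m =
      if ((p ^ r : ℕ) : ℤ) ∣ m then (x.coeff (m / ((p ^ r : ℕ) : ℤ))) ^ (p ^ r) else 0 := by
  have : Fact p.Prime := ⟨hp⟩
  have : ExpChar k p := ExpChar.prime hp
  have hq0 : 0 < p ^ r := pow_pos hp.pos r
  have hps : ∀ f : PowerSeries k, f ^ (p ^ r) =
      PowerSeries.map (iterateFrobenius k p r)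
        (PowerSeries.expand (p ^ r) (pow_ne_zero r hp.ne_zero) f) := fun f =>
    (MvPowerSeries.map_iterateFrobenius_expand p hp.ne_zero f r).symm
  have hx : x ^ (p ^ r) = single (((p ^ r : ℕ) : ℤ) * x.order) (1 : k) *
      ((x.powerSeriesPart ^ (p ^ r) : PowerSeries k) : LaurentSeries k) := by
    conv_lhs => rw [← LaurentSeries.single_order_mul_powerSeriesPart x]
    rw [mul_pow, single_pow, PowerSeries.coe_pow]
    simp
  rw [hx, coeff_single_mul, one_mul, PowerSeries.coeff_coe, hps, PowerSeries.coeff_map,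
    PowerSeries.coeff_expand, iterateFrobenius_def]
  clear hps hx
  generalize p ^ r = q at *
  have hqz : (0 : ℤ) < q := by exact_mod_cast hq0
  by_cases hd : (q : ℤ) ∣ m
  · obtain ⟨n, rfl⟩ := hd
    rw [if_pos (dvd_mul_right _ _), ← mul_sub, Int.mul_ediv_cancel_left _ hqz.ne']
    split_ifs with h1 h2
    · have : n < x.order := by nlinarith
      rw [coeff_eq_zero_of_lt_order this, zero_pow hq0.ne']
    · have h3 : 0 ≤ n - x.order := by nlinarith
      rw [Int.natAbs_mul, Int.natAbs_natCast, Nat.mul_div_cancel_left _ hq0,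
        LaurentSeries.powerSeriesPart_coeff, Int.natAbs_of_nonneg h3,
        add_sub_cancel]
    · exact absurd (by rw [Int.natAbs_mul, Int.natAbs_natCast]; exact dvd_mul_right _ _) h2
  · rw [if_neg hd]
    split_ifs with h1 h2
    · rfl
    · exfalso
      apply hd
      rw [← Int.natCast_dvd] at h2
      have := dvd_add h2 (dvd_mul_right (q : ℤ) x.order)
      simpa using this
    · exact zero_pow hq0.ne'

open HahnSeries in
theorem aux_coeff_sum (p r : ℕ) (hp : p.Prime) (k : Type*) [Field k] [CharP k p]
    (a : Fin (p ^ r) → LaurentSeries k) (n : ℤ) (j : Fin (p ^ r)) :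
    (∑ i, a i ^ (p ^ r) * (single (i : ℤ) (1 : k) : LaurentSeries k)).coeff
      (((p ^ r : ℕ) : ℤ) * n + j) = (a j).coeff n ^ (p ^ r) := by
  have hq0 : 0 < p ^ r := pow_pos hp.pos r
  have hqz : (0 : ℤ) < (p ^ r : ℕ) := by exact_mod_cast hq0
  rw [HahnSeries.coeff_sum, Finset.sum_eq_single j]
  · rw [coeff_mul_single, aux_coeff_pow p r hp, add_sub_cancel_right,
      if_pos (dvd_mul_right _ _), Int.mul_ediv_cancel_left _ hqz.ne', mul_one]
  · intro i _ hij
    rw [coeff_mul_single, aux_coeff_pow p r hp, if_neg, zero_mul]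
    intro hd
    rw [add_sub_assoc, dvd_add_right (dvd_mul_right _ _)] at hd
    have h1 := i.isLt
    have h2 := j.isLt
    have := Int.eq_zero_of_abs_lt_dvd hd (by rw [abs_lt]; constructor <;> omega)
    apply hij
    ext
    omega
  · simp

/-- Let `k` be a finite field of characteristic `p`, `r ≥ 1`, `q = p ^ r`, and
`F = k((X))` the field of Laurent series.  If `Fq` is the subfield
`F^q = {x ^ q : x ∈ F}` of `F`, then `F` is a finite extension of `Fq` of degree
exactly `q`. -/
theorem laurentSeries_rank_over_q_powers
    (p r : ℕ) (hp : p.Prime) (hr : 1 ≤ r)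
    (k : Type*) [Field k] [Finite k] [CharP k p]
    (Fq : Subfield (LaurentSeries k))
    (hFq : (Fq : Set (LaurentSeries k)) =
      Set.range (fun x : LaurentSeries k => x ^ (p ^ r))) :
    FiniteDimensional Fq (LaurentSeries k) ∧
      Module.finrank Fq (LaurentSeries k) = p ^ r := by
  have : Fact p.Prime := ⟨hp⟩
  have : ExpChar k p := ExpChar.prime hp
  have hq0 : 0 < p ^ r := pow_pos hp.pos r
  have hqz : (0 : ℤ) < (p ^ r : ℕ) := by exact_mod_cast hq0
  have hmem : ∀ y, y ∈ Fq ↔ ∃ x : LaurentSeries k, x ^ (p ^ r) = y := by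
    intro y
    rw [← SetLike.mem_coe, hFq]
    rfl
  let v : Fin (p ^ r) → LaurentSeries k := fun i => HahnSeries.single (i : ℤ) (1 : k)
  have hli : LinearIndependent Fq v := by
    rw [Fintype.linearIndependent_iff]
    intro g hg
    choose a ha using fun i => (hmem (g i)).1 (g i).2
    have hs : ∑ i, a i ^ (p ^ r) * v i = 0 := by
      rw [← hg]
      refine Finset.sum_congr rfl fun i _ => ?_
      rw [ha]
      rfl
    intro j
    have haj : a j = 0 := by
      ext n
      have := aux_coeff_sum p r hp k a n j
      rw [hs] at this
      simpa using (pow_eq_zero_iff hq0.ne').1 this.symm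
    apply Subtype.ext
    rw [← ha, haj, zero_pow hq0.ne']
    rfl
  have hsp : ⊤ ≤ Submodule.span Fq (Set.range v) := by
    intro f _
    have hroot : ∀ c : k, ∃ d : k, d ^ (p ^ r) = c :=
      fun c => (bijective_iterateFrobenius (R := k) (p := p) (n := r)).2 c
    choose ρ hρ using hroot
    have hρ0 : ρ 0 = 0 := (pow_eq_zero_iff hq0.ne').1 (hρ 0)
    let a : Fin (p ^ r) → LaurentSeries k := fun i =>
      HahnSeries.ofSuppBddBelow (fun n : ℤ => ρ (f.coeff (((p ^ r : ℕ) : ℤ) * n + i))) (by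
        refine ⟨-|f.order| - 1, ?_⟩
        intro n hn
        by_contra hlt
        apply hn
        have h1 := i.isLt
        have h2 := neg_abs_le f.order
        have h3 := abs_nonneg f.order
        have : ((p ^ r : ℕ) : ℤ) * n + i < f.order := by
          have h4 : (i : ℤ) < (p ^ r : ℕ) := by exact_mod_cast h1
          push Not at hlt
          nlinarith
        simp only [HahnSeries.coeff_eq_zero_of_lt_order this, hρ0])
    have hf : f = ∑ i, a i ^ (p ^ r) * v i := by
      ext m
      have hm0 := Int.emod_nonneg m hqz.ne'
      have hm1 := Int.emod_lt_of_pos m hqz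
      let j : Fin (p ^ r) := ⟨(m % (p ^ r : ℕ)).toNat, by omega⟩
      have hj : m = ((p ^ r : ℕ) : ℤ) * (m / (p ^ r : ℕ)) + (j : ℕ) := by
        have := Int.mul_ediv_add_emod m (p ^ r : ℕ)
        have h2 : ((j : ℕ) : ℤ) = m % (p ^ r : ℕ) := Int.toNat_of_nonneg hm0
        rw [h2, this]
      rw [hj, aux_coeff_sum p r hp k a _ j]
      exact (hρ _).symm
    rw [hf]
    refine Submodule.sum_mem _ fun i _ => ?_
    exact Submodule.smul_mem _ (⟨a i ^ (p ^ r), (hmem _).2 ⟨_, rfl⟩⟩ : Fq)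
      (Submodule.subset_span ⟨i, rfl⟩)
  let b := Module.Basis.mk hli hsp
  refine ⟨Module.Finite.of_basis b, ?_⟩
  rw [Module.finrank_eq_card_basis b, Fintype.card_fin]
end
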